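/- arXiv:2508.18731 — 7 statements merged into one kernel-verified Lean document; each statement's English description precedes it below -/
import Mathlib

section
/- Let σ, B, C, τ_Q, K_1, K_2 be positive constants and let ε > 0 be sufficiently small. There exist constants n_0, C' and c > 0 (depending only on these parameters) such that the following holds for all n ≥ n_0. Let G be a graph on [n] with degree sequence g and let d be a positive integer sequence with even sum satisfying Assumptions (a), (c), (d). Define β ∈ ℝ^n by β_j := (1/2) log(λ/(1−λ)) + γ_j, where γ := Λ^{−1} Q(G)^{−1}(d − λg). Suppose ‖d − λg‖_∞ ≤ K_1 Λ^{3/4} n^{3/4−σ/4} and ‖d − λg‖_2 ≤ K_2 Λ^{1/2} n^{1+ε/2}. Then |β_j − β_k| ≤ C' for all j, k ∈ [n], and the vector δ = δ(β) satisfies ‖δ‖_∞ ≤ c Λ^{−1} n^{−1} ‖d − λg‖_∞² and ‖δ‖_1 ≤ c Λ^{−1} n^{−1} ‖d − λg‖_2². -/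
open scoped BigOperators Classical
open Matrix

noncomputable section

/-- The degree `g_j` of vertex `j` in `G`. -/
def degS {n : ℕ} (G : SimpleGraph (Fin n)) (j : Fin n) : ℕ := (G.neighborSet j).ncard

/-- `λ_{jk}(β) = e^{β_j+β_k}/(1+e^{β_j+β_k})`. -/
def lamE {n : ℕ} (β : Fin n → ℝ) (j k : Fin n) : ℝ :=
  Real.exp (β j + β k) / (1 + Real.exp (β j + β k))

/-- `δ_j = Σ_{k : jk∈E(G)} λ_{jk} − d_j`. -/
def deltaV {n : ℕ} (G : SimpleGraph (Fin n)) (β : Fin n → ℝ) (d : Fin n → ℕ) (j : Fin n) : ℝ :=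
  (∑ k, if G.Adj j k then lamE β j k else 0) - (d j : ℝ)

/-- `λ = (Σ_j d_j)/(Σ_j g_j)`. -/
def lamAvg {n : ℕ} (G : SimpleGraph (Fin n)) (d : Fin n → ℕ) : ℝ :=
  (∑ j, (d j : ℝ)) / ∑ j, (degS G j : ℝ)

/-- `Λ = λ(1−λ)`. -/
def LamV {n : ℕ} (G : SimpleGraph (Fin n)) (d : Fin n → ℕ) : ℝ :=
  lamAvg G d * (1 - lamAvg G d)

/-- The number of edges of `G` with exactly one end in `U`. -/
def edgeBoundaryCard {n : ℕ} (G : SimpleGraph (Fin n)) (U : Finset (Fin n)) : ℕ :=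
  (Finset.univ.filter fun p : Fin n × Fin n => G.Adj p.1 p.2 ∧ p.1 ∈ U ∧ p.2 ∉ U).card

/-- `h(G) ≥ x`: lower bound on the Cheeger (isoperimetric) constant of `G`. -/
def CheegerLB {n : ℕ} (G : SimpleGraph (Fin n)) (x : ℝ) : Prop :=
  ∀ U : Finset (Fin n), U.Nonempty → (U.card : ℝ) ≤ (n : ℝ) / 2 →
    x * (U.card : ℝ) ≤ (edgeBoundaryCard G U : ℝ)

/-- The signless Laplacian `Q(G)`. -/
def signlessLap {n : ℕ} (G : SimpleGraph (Fin n)) : Matrix (Fin n) (Fin n) ℝ :=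
  Matrix.of fun j k => if j = k then (degS G j : ℝ) else if G.Adj j k then 1 else 0

/-- The vector `d − λg`. -/
def dresid {n : ℕ} (G : SimpleGraph (Fin n)) (d : Fin n → ℕ) : Fin n → ℝ :=
  fun j => (d j : ℝ) - lamAvg G d * (degS G j : ℝ)

/-- `β_j = (1/2) log(λ/(1−λ)) + γ_j` where `γ = Λ⁻¹ Q(G)⁻¹ (d − λg)`. -/
def betaOf {n : ℕ} (G : SimpleGraph (Fin n)) (d : Fin n → ℕ) : Fin n → ℝ := fun j =>
  (1 / 2) * Real.log (lamAvg G d / (1 - lamAvg G d)) +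
    (LamV G d)⁻¹ * (signlessLap G)⁻¹.mulVec (dresid G d) j

/-- The logistic function at `log (l / (1 - l)) + s`, compared with its linearisation at `s = 0`. -/
theorem abs_logistic_sub_linear_le {l s S : ℝ} (h0 : 0 < l) (h1 : l < 1) (hs : |s| ≤ S) :
    |l / (1 - l) * Real.exp s / (1 + l / (1 - l) * Real.exp s) - l - l * (1 - l) * s| ≤
      l * (1 - l) * (2 * Real.exp (2 * S)) * s ^ 2 := by
  have hl : 0 < 1 - l := by linarith
  have hE := Real.exp_pos s
  have hD : 0 < 1 - l + l * Real.exp s := by positivity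
  have hDlow : Real.exp (-|s|) ≤ 1 - l + l * Real.exp s := by
    have e1 : Real.exp (-|s|) ≤ 1 := by simp
    have e2 : Real.exp (-|s|) ≤ Real.exp s := Real.exp_le_exp.2 (neg_abs_le s)
    nlinarith
  have hexp : |Real.exp s - 1| ≤ |s| * Real.exp |s| := by
    rcases le_total 0 s with h | h
    · have e1 := Real.add_one_le_exp (-s)
      have e2 : Real.exp (-s) * Real.exp s = 1 := by rw [← Real.exp_add]; simp
      rw [abs_of_nonneg h, abs_of_nonneg (by linarith [Real.add_one_le_exp s])]
      nlinarith
    · have e1 : Real.exp s ≤ 1 := Real.exp_le_one_iff.2 h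
      rw [abs_of_nonpos h, abs_of_nonpos (by linarith)]
      have e2 := Real.add_one_le_exp s
      have e3 : 1 ≤ Real.exp (-s) := Real.one_le_exp (by linarith)
      nlinarith
  have hquad : |Real.exp s - 1 - s| ≤ |s| * |Real.exp s - 1| := by
    rw [← abs_mul, abs_of_nonneg (by linarith [Real.add_one_le_exp s])]
    refine le_trans ?_ (le_abs_self _)
    have e1 := Real.add_one_le_exp (-s)
    have e2 : Real.exp (-s) * Real.exp s = 1 := by rw [← Real.exp_add]; simp
    nlinarith
  have hnum : |Real.exp s - 1 - s - s * l * (Real.exp s - 1)| ≤ 2 * s ^ 2 * Real.exp |s| := by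
    have e1 : |s * l * (Real.exp s - 1)| ≤ |s| * |Real.exp s - 1| := by
      rw [abs_mul, abs_mul, abs_of_pos h0]
      gcongr
      exact mul_le_of_le_one_right (abs_nonneg _) h1.le
    have e2 : |s| * |Real.exp s - 1| ≤ s ^ 2 * Real.exp |s| := by
      calc |s| * |Real.exp s - 1| ≤ |s| * (|s| * Real.exp |s|) := by gcongr
        _ = |s| ^ 2 * Real.exp |s| := by ring
        _ = _ := by rw [sq_abs]
    calc _ ≤ |Real.exp s - 1 - s| + |s * l * (Real.exp s - 1)| := abs_sub _ _
      _ ≤ _ := by linarith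
  have heq : l / (1 - l) * Real.exp s / (1 + l / (1 - l) * Real.exp s) - l - l * (1 - l) * s =
      l * (1 - l) * ((Real.exp s - 1 - s - s * l * (Real.exp s - 1)) /
        (1 - l + l * Real.exp s)) := by
    have : 1 + l / (1 - l) * Real.exp s = (1 - l + l * Real.exp s) / (1 - l) := by
      field_simp
    rw [this]
    field_simp
    ring
  rw [heq, abs_mul, abs_of_pos (mul_pos h0 hl), mul_assoc (l * (1 - l)), abs_div, abs_of_pos hD]
  refine mul_le_mul_of_nonneg_left ?_ (mul_pos h0 hl).le
  rw [div_le_iff₀ hD]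
  have e3 : Real.exp |s| ≤ Real.exp (2 * S) * Real.exp (-|s|) := by
    rw [← Real.exp_add]
    exact Real.exp_le_exp.2 (by linarith)
  calc _ ≤ 2 * s ^ 2 * Real.exp |s| := hnum
    _ ≤ 2 * s ^ 2 * (Real.exp (2 * S) * (1 - l + l * Real.exp s)) := by
      gcongr
      exact e3.trans (by gcongr)
    _ = _ := by ring

theorem degS_eq_sum {n : ℕ} (G : SimpleGraph (Fin n)) (j : Fin n) :
    (degS G j : ℝ) = ∑ k, if G.Adj j k then (1 : ℝ) else 0 := by
  rw [degS, Set.ncard_eq_toFinset_card', Finset.sum_boole]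
  congr 2
  ext k
  simp

theorem signlessLap_mulVec_apply {n : ℕ} (G : SimpleGraph (Fin n)) (x : Fin n → ℝ) (j : Fin n) :
    (signlessLap G).mulVec x j = degS G j * x j + ∑ k, if G.Adj j k then x k else 0 := by
  have h : ∀ k, signlessLap G j k * x k =
      (if j = k then degS G j * x k else 0) + if G.Adj j k then x k else 0 := by
    intro k
    by_cases hjk : j = k
    · subst hjk
      simp [signlessLap]
    · simp [signlessLap, hjk]
  simp only [Matrix.mulVec, dotProduct, h, Finset.sum_add_distrib]
  simp

theorem mulVec_inv_mulVec_of_coercive {n : ℕ} {Q : Matrix (Fin n) (Fin n) ℝ} {t : ℝ} (ht : 0 < t)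
    (hQ : ∀ θ : Fin n → ℝ, t * ∑ j, θ j ^ 2 ≤ θ ⬝ᵥ Q.mulVec θ) (y : Fin n → ℝ) :
    Q.mulVec (Q⁻¹.mulVec y) = y := by
  have hinj : Function.Injective Q.mulVec := by
    intro a b hab
    have hz : Q.mulVec (a - b) = 0 := by
      rw [Matrix.mulVec_sub]
      exact sub_eq_zero.2 hab
    have h := hQ (a - b)
    rw [hz, dotProduct_zero] at h
    have hs : ∑ j, (a - b) j ^ 2 = 0 :=
      le_antisymm (nonpos_of_mul_nonpos_right h ht) (Finset.sum_nonneg fun _ _ => sq_nonneg _)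
    rw [Finset.sum_eq_zero_iff_of_nonneg fun _ _ => sq_nonneg _] at hs
    ext j
    exact sub_eq_zero.1 (pow_eq_zero_iff two_ne_zero |>.1 (hs j (Finset.mem_univ j)))
  have hdet := (Matrix.isUnit_iff_isUnit_det Q).1 (Matrix.mulVec_injective_iff_isUnit.1 hinj)
  rw [Matrix.mulVec_mulVec, Matrix.mul_nonsing_inv _ hdet, Matrix.one_mulVec]

theorem sum_sq_le_of_coercive {n : ℕ} {Q : Matrix (Fin n) (Fin n) ℝ} {t : ℝ} (ht : 0 < t)
    {x : Fin n → ℝ} (hQ : t * ∑ j, x j ^ 2 ≤ x ⬝ᵥ Q.mulVec x) :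
    t ^ 2 * ∑ j, x j ^ 2 ≤ ∑ j, Q.mulVec x j ^ 2 := by
  have hX : 0 ≤ ∑ j, x j ^ 2 := Finset.sum_nonneg fun _ _ => sq_nonneg _
  have hCS : (x ⬝ᵥ Q.mulVec x) ^ 2 ≤ (∑ j, x j ^ 2) * ∑ j, Q.mulVec x j ^ 2 :=
    Finset.sum_mul_sq_le_sq_mul_sq _ _ _
  have h2 := pow_le_pow_left₀ (by positivity) hQ 2
  rcases hX.eq_or_lt with h | h
  · rw [← h, mul_zero]
    exact Finset.sum_nonneg fun _ _ => sq_nonneg _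
  · refine le_of_mul_le_mul_left ?_ h
    calc _ = (t * ∑ j, x j ^ 2) ^ 2 := by ring
      _ ≤ _ := h2.trans hCS

theorem le_degS_of_coercive {n : ℕ} {G : SimpleGraph (Fin n)} {t : ℝ}
    (hQ : ∀ θ : Fin n → ℝ, t * ∑ j, θ j ^ 2 ≤ θ ⬝ᵥ (signlessLap G).mulVec θ) (j : Fin n) :
    t ≤ degS G j := by
  have h := hQ (Pi.single j 1)
  simpa [Pi.single_apply, signlessLap] using h

/-- A lower bound of order `n` on the least eigenvalue of `Q(G)` bounds `Q(G)⁻¹` in sup norm. -/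
theorem abs_le_of_signlessLap_coercive {n : ℕ} {G : SimpleGraph (Fin n)} {τ : ℝ} (hn : 0 < n)
    (hτ : 0 < τ)
    (hQ : ∀ θ : Fin n → ℝ, τ * n * ∑ j, θ j ^ 2 ≤ θ ⬝ᵥ (signlessLap G).mulVec θ)
    (x : Fin n → ℝ) (j : Fin n) :
    |x j| ≤ (1 + 1 / τ) / τ * ‖(signlessLap G).mulVec x‖ / n := by
  have hn' : (0 : ℝ) < n := Nat.cast_pos.2 hn
  set y := (signlessLap G).mulVec x with hy
  have hyj : ∀ k, |y k| ≤ ‖y‖ := fun k => norm_le_pi_norm y k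
  have hX := sum_sq_le_of_coercive (mul_pos hτ hn') (hQ x)
  rw [← hy] at hX
  have hY : ∑ k, y k ^ 2 ≤ n * ‖y‖ ^ 2 := by
    calc _ ≤ ∑ _k : Fin n, ‖y‖ ^ 2 :=
          Finset.sum_le_sum fun k _ => sq_le_sq.2 (by simpa using hyj k)
      _ = _ := by simp
  have hA : (∑ k, if G.Adj j k then x k else 0) ^ 2 ≤ n * ∑ k, x k ^ 2 := by
    have h := sq_sum_le_card_mul_sum_sq (s := Finset.univ)
      (f := fun k => if G.Adj j k then x k else 0)
    rw [Finset.card_univ, Fintype.card_fin] at h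
    refine h.trans (mul_le_mul_of_nonneg_left (Finset.sum_le_sum fun k _ => ?_) hn'.le)
    split_ifs
    · exact le_rfl
    · rw [zero_pow two_ne_zero]
      exact sq_nonneg _
  have hA' : |∑ k, if G.Adj j k then x k else 0| ≤ ‖y‖ / τ := by
    refine abs_le_of_sq_le_sq ?_ (by positivity)
    rw [div_pow, le_div_iff₀ (by positivity)]
    have h : τ ^ 2 * (∑ k, x k ^ 2) * n ^ 2 ≤ ‖y‖ ^ 2 * n := by nlinarith
    have h' : τ ^ 2 * (∑ k, x k ^ 2) * n ≤ ‖y‖ ^ 2 := by nlinarith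
    nlinarith [sq_nonneg τ]
  have hg := le_degS_of_coercive hQ j
  have hj : degS G j * x j = y j - ∑ k, if G.Adj j k then x k else 0 := by
    rw [hy, signlessLap_mulVec_apply]
    ring
  have hgx : τ * n * |x j| ≤ ‖y‖ + ‖y‖ / τ := by
    calc τ * n * |x j| ≤ degS G j * |x j| := by gcongr
      _ = |degS G j * x j| := by rw [abs_mul, Nat.abs_cast]
      _ ≤ |y j| + |∑ k, if G.Adj j k then x k else 0| := by rw [hj]; exact abs_sub _ _
      _ ≤ _ := add_le_add (hyj j) hA'
  rw [le_div_iff₀ hn', div_mul_eq_mul_div, le_div_iff₀ hτ]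
  calc |x j| * n * τ = τ * n * |x j| := by ring
    _ ≤ _ := hgx
    _ = _ := by ring

theorem lamAvg_mem_Ioo {n : ℕ} {G : SimpleGraph (Fin n)} {d : Fin n → ℕ} (h : 0 < LamV G d) :
    0 < lamAvg G d ∧ lamAvg G d < 1 := by
  have h0 : 0 ≤ lamAvg G d := by unfold lamAvg; positivity
  rw [LamV] at h
  refine ⟨h0.lt_of_ne ?_, sub_pos.1 (pos_of_mul_pos_right h h0)⟩
  intro h'
  simp [← h'] at h

theorem lamE_betaOf {n : ℕ} {G : SimpleGraph (Fin n)} {d : Fin n → ℕ} (h : 0 < LamV G d)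
    (j k : Fin n) :
    lamE (betaOf G d) j k =
      lamAvg G d / (1 - lamAvg G d) *
          Real.exp ((LamV G d)⁻¹ * (signlessLap G)⁻¹.mulVec (dresid G d) j +
            (LamV G d)⁻¹ * (signlessLap G)⁻¹.mulVec (dresid G d) k) /
        (1 + lamAvg G d / (1 - lamAvg G d) *
          Real.exp ((LamV G d)⁻¹ * (signlessLap G)⁻¹.mulVec (dresid G d) j +
            (LamV G d)⁻¹ * (signlessLap G)⁻¹.mulVec (dresid G d) k)) := by
  obtain ⟨h0, h1⟩ := lamAvg_mem_Ioo h
  have hr : 0 < lamAvg G d / (1 - lamAvg G d) := div_pos h0 (sub_pos.2 h1)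
  have he : betaOf G d j + betaOf G d k = Real.log (lamAvg G d / (1 - lamAvg G d)) +
      ((LamV G d)⁻¹ * (signlessLap G)⁻¹.mulVec (dresid G d) j +
        (LamV G d)⁻¹ * (signlessLap G)⁻¹.mulVec (dresid G d) k) := by
    simp only [betaOf]
    ring
  rw [lamE, he, Real.exp_add, Real.exp_log hr]

/-- The first-order terms of `δ(β)` cancel when `Q(G)` is invertible. -/
theorem deltaV_betaOf {n : ℕ} {G : SimpleGraph (Fin n)} {d : Fin n → ℕ} (h : 0 < LamV G d)
    (hinv : (signlessLap G).mulVec ((signlessLap G)⁻¹.mulVec (dresid G d)) = dresid G d)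
    (j : Fin n) :
    deltaV G (betaOf G d) d j = ∑ k, if G.Adj j k then
      lamE (betaOf G d) j k - lamAvg G d - LamV G d *
        ((LamV G d)⁻¹ * (signlessLap G)⁻¹.mulVec (dresid G d) j +
          (LamV G d)⁻¹ * (signlessLap G)⁻¹.mulVec (dresid G d) k) else 0 := by
  have hj := congrFun hinv j
  rw [signlessLap_mulVec_apply, dresid] at hj
  set x := (signlessLap G)⁻¹.mulVec (dresid G d)
  have hk : ∀ k, (if G.Adj j k then lamE (betaOf G d) j k - lamAvg G d - LamV G d *
        ((LamV G d)⁻¹ * x j + (LamV G d)⁻¹ * x k) else 0) =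
      (if G.Adj j k then lamE (betaOf G d) j k else 0) -
        (lamAvg G d + x j) * (if G.Adj j k then 1 else 0) - (if G.Adj j k then x k else 0) := by
    intro k
    split_ifs
    · field_simp
      ring
    · simp
  simp only [hk, Finset.sum_sub_distrib, ← Finset.mul_sum, ← degS_eq_sum, deltaV]
  linarith

theorem inv_mul_rpow_bound {B σ L : ℝ} {n : ℕ} (hn : 0 < n) (hσ : 0 < σ) (hB : 0 < B)
    (hL : B * (n : ℝ) ^ (σ - 1) ≤ L) :
    L⁻¹ * (L ^ ((3 : ℝ) / 4) * (n : ℝ) ^ ((3 : ℝ) / 4 - σ / 4) / n) ≤ B ^ (-(1 : ℝ) / 4) := by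
  have hn' : (0 : ℝ) < n := Nat.cast_pos.2 hn
  have hn1 : (1 : ℝ) ≤ n := Nat.one_le_cast.2 hn
  have hpos : 0 < B * (n : ℝ) ^ (σ - 1) := by positivity
  have hLpos : 0 < L := hpos.trans_le hL
  have e1 : L⁻¹ * L ^ ((3 : ℝ) / 4) = L ^ (-(1 : ℝ) / 4) := by
    rw [← Real.rpow_neg_one, ← Real.rpow_add hLpos]
    norm_num
  have e2 : (n : ℝ) ^ ((3 : ℝ) / 4 - σ / 4) / n = (n : ℝ) ^ (-(1 : ℝ) / 4 - σ / 4) := by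
    rw [← Real.rpow_sub_one hn'.ne']
    ring_nf
  have e3 : L ^ (-(1 : ℝ) / 4) ≤ B ^ (-(1 : ℝ) / 4) * (n : ℝ) ^ ((σ - 1) * (-(1 : ℝ) / 4)) := by
    rw [Real.rpow_mul hn'.le, ← Real.mul_rpow hB.le (by positivity)]
    exact Real.rpow_le_rpow_of_nonpos hpos hL (by norm_num)
  calc _ = L ^ (-(1 : ℝ) / 4) * (n : ℝ) ^ (-(1 : ℝ) / 4 - σ / 4) := by
        rw [← e1, ← e2]
        ring
    _ ≤ B ^ (-(1 : ℝ) / 4) * (n : ℝ) ^ ((σ - 1) * (-(1 : ℝ) / 4)) *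
        (n : ℝ) ^ (-(1 : ℝ) / 4 - σ / 4) := by gcongr
    _ = B ^ (-(1 : ℝ) / 4) * (n : ℝ) ^ (-(σ / 2)) := by
        rw [mul_assoc, ← Real.rpow_add hn']
        ring_nf
    _ ≤ B ^ (-(1 : ℝ) / 4) :=
        mul_le_of_le_one_right (by positivity)
          (Real.rpow_le_one_of_one_le_of_nonpos hn1 (by linarith))

/-- Under Assumptions (a), (c), (d), if
`‖d − λg‖_∞ ≤ K₁ Λ^{3/4} n^{3/4−σ/4}` and `‖d − λg‖₂ ≤ K₂ Λ^{1/2} n^{1+ε/2}`, then the vector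
`β` defined by `β_j = (1/2)log(λ/(1−λ)) + γ_j`, `γ = Λ⁻¹Q(G)⁻¹(d−λg)`, satisfies
`|β_j − β_k| ≤ C'` for all `j,k`, and `δ(β)` satisfies
`‖δ‖_∞ ≤ c Λ⁻¹ n⁻¹ ‖d−λg‖_∞²` and `‖δ‖₁ ≤ c Λ⁻¹ n⁻¹ ‖d−λg‖₂²`.
(Here `‖·‖` is the sup norm on `Fin n → ℝ`.) -/
theorem good_beta (σv B C τQ K₁ K₂ : ℝ)
    (hσ : 0 < σv) (hB : 0 < B) (hC : 0 < C) (hτ : 0 < τQ) (hK₁ : 0 < K₁) (hK₂ : 0 < K₂) :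
    ∃ ε₀ : ℝ, 0 < ε₀ ∧ ∀ ε : ℝ, 0 < ε → ε ≤ ε₀ →
      ∃ (n₀ : ℕ) (C' c : ℝ), 0 < c ∧
        ∀ n : ℕ, n₀ ≤ n → ∀ (G : SimpleGraph (Fin n)) (d : Fin n → ℕ),
          (∀ j, 0 < d j) → Even (∑ j, d j) →
          -- Assumption (a)
          (∀ j, d j ≤ degS G j) →
          -- Assumption (c)
          (B * (n : ℝ) ^ (σv - 1) ≤ LamV G d) →
          -- Assumption (d)
          CheegerLB G ((LamV G d)⁻¹ * (Real.log n) ^ 2) →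
          (∀ θ : Fin n → ℝ, τQ * (n : ℝ) * ∑ j, (θ j) ^ 2 ≤ θ ⬝ᵥ (signlessLap G).mulVec θ) →
          -- ‖d − λg‖_∞ and ‖d − λg‖₂ hypotheses
          (‖dresid G d‖ ≤ K₁ * (LamV G d) ^ ((3 : ℝ) / 4) * (n : ℝ) ^ ((3 : ℝ) / 4 - σv / 4)) →
          (Real.sqrt (∑ j, dresid G d j ^ 2) ≤
            K₂ * (LamV G d) ^ ((1 : ℝ) / 2) * (n : ℝ) ^ (1 + ε / 2)) →
          (∀ j k, |betaOf G d j - betaOf G d k| ≤ C') ∧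
          ‖fun j => deltaV G (betaOf G d) d j‖ ≤
            c * (LamV G d)⁻¹ * (n : ℝ)⁻¹ * ‖dresid G d‖ ^ 2 ∧
          (∑ j, |deltaV G (betaOf G d) d j|) ≤
            c * (LamV G d)⁻¹ * (n : ℝ)⁻¹ * ∑ j, dresid G d j ^ 2 := by
  refine ⟨1, one_pos, fun ε _ _ => ?_⟩
  set a : ℝ := (1 + 1 / τQ) / τQ with ha
  have hapos : 0 < a := by positivity
  set M : ℝ := a * K₁ * B ^ (-(1 : ℝ) / 4) with hM
  set K : ℝ := 2 * Real.exp (2 * (2 * M)) with hK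
  have hKpos : 0 < K := by positivity
  refine ⟨1, 2 * M, 4 * K * (a ^ 2 + 1 / τQ ^ 2), by positivity, ?_⟩
  intro n hn G d _ _ _ hL _ hQ hsup _
  have hn' : (0 : ℝ) < n := Nat.cast_pos.2 hn
  have hLpos : 0 < LamV G d := lt_of_lt_of_le (by positivity) hL
  obtain ⟨h0, h1⟩ := lamAvg_mem_Ioo hLpos
  have ht : 0 < τQ * n := mul_pos hτ hn'
  have hinv := mulVec_inv_mulVec_of_coercive ht hQ (dresid G d)
  have hδ := deltaV_betaOf hLpos hinv
  have hx := abs_le_of_signlessLap_coercive hn hτ hQ ((signlessLap G)⁻¹.mulVec (dresid G d))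
  have hx2 := sum_sq_le_of_coercive ht (hQ ((signlessLap G)⁻¹.mulVec (dresid G d)))
  rw [hinv] at hx hx2
  set γ : Fin n → ℝ := fun j => (LamV G d)⁻¹ * (signlessLap G)⁻¹.mulVec (dresid G d) j with hγ
  set y := dresid G d
  set L := LamV G d with hLdef
  have hγm : ∀ j, |γ j| ≤ L⁻¹ * (a * ‖y‖ / n) := by
    intro j
    rw [hγ, abs_mul, abs_of_pos (inv_pos.2 hLpos)]
    exact mul_le_mul_of_nonneg_left (hx j) (inv_pos.2 hLpos).le
  have hγM : ∀ j, |γ j| ≤ M := by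
    intro j
    calc |γ j| ≤ L⁻¹ * (a * ‖y‖ / n) := hγm j
      _ ≤ L⁻¹ * (a * (K₁ * L ^ ((3 : ℝ) / 4) * (n : ℝ) ^ ((3 : ℝ) / 4 - σv / 4)) / n) := by
          gcongr
      _ = a * K₁ * (L⁻¹ * (L ^ ((3 : ℝ) / 4) * (n : ℝ) ^ ((3 : ℝ) / 4 - σv / 4) / n)) := by ring
      _ ≤ M := mul_le_mul_of_nonneg_left (inv_mul_rpow_bound hn hσ hB hL) (by positivity)
  have hγ2 : ∑ j, γ j ^ 2 ≤ L⁻¹ ^ 2 * ((∑ j, y j ^ 2) / (τQ * n) ^ 2) := by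
    simp only [hγ, mul_pow, ← Finset.mul_sum]
    refine mul_le_mul_of_nonneg_left ?_ (by positivity)
    rw [le_div_iff₀ (by positivity), ← mul_pow]
    linarith
  have herr : ∀ j k, |if G.Adj j k then lamE (betaOf G d) j k - lamAvg G d - L * (γ j + γ k)
      else 0| ≤ 2 * L * K * (γ j ^ 2 + γ k ^ 2) := by
    intro j k
    split_ifs
    · rw [lamE_betaOf hLpos]
      have hs : |γ j + γ k| ≤ 2 * M :=
        (abs_add_le _ _).trans (by linarith [hγM j, hγM k])
      refine (abs_logistic_sub_linear_le h0 h1 hs).trans ?_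
      change L * K * (γ j + γ k) ^ 2 ≤ _
      have : (γ j + γ k) ^ 2 ≤ 2 * (γ j ^ 2 + γ k ^ 2) := add_sq_le
      calc _ ≤ L * K * (2 * (γ j ^ 2 + γ k ^ 2)) := by gcongr
        _ = _ := by ring
    · rw [abs_zero]
      positivity
  have hδle : ∀ j, |deltaV G (betaOf G d) d j| ≤ ∑ k, 2 * L * K * (γ j ^ 2 + γ k ^ 2) := by
    intro j
    rw [hδ j]
    exact (Finset.abs_sum_le_sum_abs _ _).trans (Finset.sum_le_sum fun k _ => herr j k)
  refine ⟨fun j k => ?_, ?_, ?_⟩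
  · have hb : betaOf G d j - betaOf G d k = γ j - γ k := by
      simp only [betaOf, hγ]
      ring
    rw [hb]
    exact (abs_sub _ _).trans (by linarith [hγM j, hγM k])
  · refine (pi_norm_le_iff_of_nonneg (by positivity)).2 fun j => ?_
    rw [Real.norm_eq_abs]
    have hsq : ∀ k, γ k ^ 2 ≤ (L⁻¹ * (a * ‖y‖ / n)) ^ 2 := fun k =>
      sq_le_sq' (abs_le.1 (hγm k)).1 (abs_le.1 (hγm k)).2
    calc _ ≤ _ := hδle j
      _ ≤ ∑ _k : Fin n, 2 * L * K *
          ((L⁻¹ * (a * ‖y‖ / n)) ^ 2 + (L⁻¹ * (a * ‖y‖ / n)) ^ 2) := by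
          exact Finset.sum_le_sum fun k _ =>
            mul_le_mul_of_nonneg_left (add_le_add (hsq j) (hsq k)) (by positivity)
      _ = 4 * K * a ^ 2 * L⁻¹ * (n : ℝ)⁻¹ * ‖y‖ ^ 2 := by
          rw [Finset.sum_const, Finset.card_univ, Fintype.card_fin, nsmul_eq_mul]
          field_simp
          ring
      _ ≤ _ := by
          gcongr
          exact le_add_of_nonneg_right (by positivity)
  · calc _ ≤ ∑ j, ∑ k, 2 * L * K * (γ j ^ 2 + γ k ^ 2) := Finset.sum_le_sum fun j _ => hδle j
      _ = 4 * L * K * n * ∑ j, γ j ^ 2 := by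
          simp only [← Finset.mul_sum, Finset.sum_add_distrib, Finset.sum_const, Finset.card_univ,
            Fintype.card_fin, nsmul_eq_mul]
          ring
      _ ≤ 4 * L * K * n * (L⁻¹ ^ 2 * ((∑ j, y j ^ 2) / (τQ * n) ^ 2)) := by gcongr
      _ = 4 * K * (1 / τQ ^ 2) * L⁻¹ * (n : ℝ)⁻¹ * ∑ j, y j ^ 2 := by
          field_simp
      _ ≤ _ := by
          gcongr
          exact le_add_of_nonneg_left (by positivity)

end
end

section
/- Let M be an n×n real positive-definite symmetric matrix with minimum eigenvalue μ_min > 0. Let D be a real diagonal n×n matrix with diagonal entries in [d_min, d_max], where d_min > 0, and suppose max_{j,k} |M_{jk} − D_{jk}| ≤ r d_min / n for some r ≥ 0. Then ‖M^{−1}‖_∞ ≤ (r d_max + μ_min)/(μ_min d_min) and max_{j,k} |(M^{−1})_{jk} − (D^{−1})_{jk}| ≤ r (r d_max + μ_min)/(μ_min d_min n). -/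
open Matrix

/-- If `μ` bounds the quadratic form of `M` from below, then a solution of `M x = y` with
`‖y‖_∞ ≤ 1` has `ℓ¹` norm at most `n / μ`. -/
lemma mul_sum_abs_le_card {n : ℕ} {M : Matrix (Fin n) (Fin n) ℝ} {μ : ℝ} (hμpos : 0 < μ)
    (hμ : ∀ x : Fin n → ℝ, μ * ∑ i, (x i) ^ 2 ≤ x ⬝ᵥ M.mulVec x)
    {x : Fin n → ℝ} (hx : ∀ i, |(M *ᵥ x) i| ≤ 1) : μ * ∑ i, |x i| ≤ n := by
  have hdot : x ⬝ᵥ M *ᵥ x ≤ ∑ i, |x i| := by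
    refine Finset.sum_le_sum fun i _ => (le_abs_self _).trans ?_
    rw [abs_mul]
    exact mul_le_of_le_one_right (abs_nonneg _) (hx i)
  have hcs : (∑ i, |x i|) ^ 2 ≤ n * ∑ i, (x i) ^ 2 := by
    simpa using sq_sum_le_card_mul_sum_sq (s := Finset.univ) (f := fun i => |x i|)
  have hs : 0 ≤ ∑ i, |x i| := Finset.sum_nonneg fun i _ => abs_nonneg _
  rcases hs.eq_or_lt with h | h
  · simp [← h]
  · refine le_of_mul_le_mul_right ?_ h
    calc μ * (∑ i, |x i|) * ∑ i, |x i| = μ * (∑ i, |x i|) ^ 2 := by ring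
      _ ≤ μ * (n * ∑ i, (x i) ^ 2) := by gcongr
      _ = n * (μ * ∑ i, (x i) ^ 2) := by ring
      _ ≤ n * ∑ i, |x i| := by gcongr; exact (hμ x).trans hdot

/-- An `ℓ∞` bound on the solution of `M x = y`, `‖y‖_∞ ≤ 1`, when `M` is entrywise close to a
diagonal matrix. -/
lemma abs_le_of_near_diagonal {n : ℕ} {M : Matrix (Fin n) (Fin n) ℝ} {μ : ℝ} (hμpos : 0 < μ)
    (hμ : ∀ x : Fin n → ℝ, μ * ∑ i, (x i) ^ 2 ≤ x ⬝ᵥ M.mulVec x)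
    {d : Fin n → ℝ} {dmin r : ℝ} (hdmin : 0 < dmin) (hd : ∀ j, dmin ≤ d j) (hr : 0 ≤ r)
    (hMD : ∀ j k, |M j k - Matrix.diagonal d j k| ≤ r * dmin / n)
    {x : Fin n → ℝ} (hx : ∀ i, |(M *ᵥ x) i| ≤ 1) (j : Fin n) :
    |x j| ≤ (r * dmin + μ) / (μ * dmin) := by
  have hn : (0 : ℝ) < n := by exact_mod_cast j.pos
  have hsum := mul_sum_abs_le_card hμpos hμ hx
  have hE : |((M - diagonal d) *ᵥ x) j| ≤ r * dmin / μ := by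
    calc |((M - diagonal d) *ᵥ x) j| ≤ ∑ k, |(M - diagonal d) j k * x k| :=
          Finset.abs_sum_le_sum_abs (fun k => (M - diagonal d) j k * x k) Finset.univ
      _ ≤ ∑ k, r * dmin / n * |x k| := by
          refine Finset.sum_le_sum fun k _ => ?_
          rw [abs_mul]
          exact mul_le_mul_of_nonneg_right (hMD j k) (abs_nonneg _)
      _ = r * dmin / n * ∑ k, |x k| := by rw [Finset.mul_sum]
      _ ≤ r * dmin / n * (n / μ) := by
          gcongr
          rwa [le_div_iff₀' hμpos]
      _ = r * dmin / μ := by field_simp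
  have hdx : d j * x j = (M *ᵥ x) j - ((M - diagonal d) *ᵥ x) j := by
    simp [sub_mulVec, mulVec_diagonal]
  have hbound : dmin * |x j| ≤ 1 + r * dmin / μ := by
    calc dmin * |x j| ≤ d j * |x j| := by gcongr; exact hd j
      _ = |d j * x j| := by rw [abs_mul, abs_of_pos (hdmin.trans_le (hd j))]
      _ ≤ |(M *ᵥ x) j| + |((M - diagonal d) *ᵥ x) j| := by rw [hdx]; exact abs_sub _ _
      _ ≤ 1 + r * dmin / μ := add_le_add (hx j) hE
  rw [← le_div_iff₀' hdmin] at hbound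
  refine hbound.trans_eq ?_
  field_simp
  ring

/-- Let `M` be an `n×n` real positive-definite symmetric matrix with minimum
eigenvalue `μ_min > 0` (expressed via the quadratic form lower bound), and let `D` be a real
diagonal matrix with entries in `[d_min, d_max]`, `d_min > 0`, with
`max_{j,k} |M_{jk} − D_{jk}| ≤ r d_min/n`.  Then
`‖M⁻¹‖_∞ ≤ (r d_max + μ_min)/(μ_min d_min)` and
`max_{j,k} |(M⁻¹ − D⁻¹)_{jk}| ≤ r(r d_max + μ_min)/(μ_min d_min n)`. -/
theorem inv_bounds_of_near_diagonal (n : ℕ) (M : Matrix (Fin n) (Fin n) ℝ)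
    (hM : M.PosDef) (μmin : ℝ) (hμpos : 0 < μmin)
    (hμ : ∀ x : Fin n → ℝ, μmin * ∑ i, (x i) ^ 2 ≤ x ⬝ᵥ M.mulVec x)
    (dd : Fin n → ℝ) (dmin dmax : ℝ) (hdmin : 0 < dmin)
    (hdd : ∀ j, dd j ∈ Set.Icc dmin dmax)
    (r : ℝ) (hr : 0 ≤ r)
    (hMD : ∀ j k, |M j k - Matrix.diagonal dd j k| ≤ r * dmin / n) :
    (∀ j, ∑ k, |M⁻¹ j k| ≤ (r * dmax + μmin) / (μmin * dmin)) ∧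
    (∀ j k, |M⁻¹ j k - (Matrix.diagonal dd)⁻¹ j k| ≤
      r * (r * dmax + μmin) / (μmin * dmin * n)) := by
  have hdet : IsUnit M.det := hM.det_pos.ne'.isUnit
  have hrow : ∀ j, ∑ k, |M⁻¹ j k| ≤ (r * dmax + μmin) / (μmin * dmin) := by
    intro j
    set y : Fin n → ℝ := fun k => SignType.sign (M⁻¹ j k)
    have hMy : M *ᵥ (M⁻¹ *ᵥ y) = y := by
      rw [mulVec_mulVec, mul_nonsing_inv _ hdet, one_mulVec]
    have hy : ∀ i, |(M *ᵥ (M⁻¹ *ᵥ y)) i| ≤ 1 := by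
      intro i
      rw [hMy]
      rcases lt_trichotomy (M⁻¹ j i) 0 with h | h | h <;> simp [y, h]
    have hxj : (M⁻¹ *ᵥ y) j = ∑ k, |M⁻¹ j k| := by
      simp [y, mulVec, dotProduct]
    calc ∑ k, |M⁻¹ j k| ≤ |(M⁻¹ *ᵥ y) j| := hxj.ge.trans (le_abs_self _)
      _ ≤ (r * dmin + μmin) / (μmin * dmin) :=
          abs_le_of_near_diagonal hμpos hμ hdmin (fun i => (hdd i).1) hr hMD hy j
      _ ≤ (r * dmax + μmin) / (μmin * dmin) := by
          gcongr
          exact (hdd j).1.trans (hdd j).2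
  refine ⟨hrow, fun j k => ?_⟩
  have hn : (0 : ℝ) < n := by exact_mod_cast j.pos
  have hdk : 0 < dd k := hdmin.trans_le (hdd k).1
  have hD : IsUnit (diagonal dd).det := by
    rw [det_diagonal]
    exact (Finset.prod_pos fun i _ => hdmin.trans_le (hdd i).1).ne'.isUnit
  have hdiff : (M⁻¹ - (diagonal dd)⁻¹) * diagonal dd = M⁻¹ * (diagonal dd - M) := by
    rw [sub_mul, mul_sub, nonsing_inv_mul _ hD, nonsing_inv_mul _ hdet]
  have hentry : (M⁻¹ j k - (diagonal dd)⁻¹ j k) * dd k =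
      ∑ l, M⁻¹ j l * (diagonal dd l k - M l k) := by
    simpa only [mul_diagonal, Matrix.sub_apply, Matrix.mul_apply (M := M⁻¹)] using congrFun (congrFun hdiff j) k
  have hbound : |M⁻¹ j k - (diagonal dd)⁻¹ j k| * dmin ≤
      (r * dmax + μmin) / (μmin * dmin) * (r * dmin / n) := by
    calc |M⁻¹ j k - (diagonal dd)⁻¹ j k| * dmin
        ≤ |M⁻¹ j k - (diagonal dd)⁻¹ j k| * dd k := by gcongr; exact (hdd k).1
      _ = |∑ l, M⁻¹ j l * (diagonal dd l k - M l k)| := by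
          rw [← hentry, abs_mul, abs_of_pos hdk]
      _ ≤ ∑ l, |M⁻¹ j l| * (r * dmin / n) := by
          refine (Finset.abs_sum_le_sum_abs _ _).trans (Finset.sum_le_sum fun l _ => ?_)
          rw [abs_mul, abs_sub_comm (diagonal dd l k)]
          exact mul_le_mul_of_nonneg_left (hMD l k) (abs_nonneg _)
      _ ≤ (r * dmax + μmin) / (μmin * dmin) * (r * dmin / n) := by
          rw [← Finset.sum_mul]
          gcongr
          exact hrow j
  refine le_of_mul_le_mul_right (hbound.trans_eq ?_) hdmin
  field_simp
end

section
/- Let M be an n×n real matrix and let J ⊆ [n]. Let M_J be the n×n matrix whose j-th column equals the j-th standard basis vector e_j if j ∉ J, and equals the j-th column of M if j ∈ J. Then |det(M_J)| ≤ ‖M‖_∞^{|J|}, where ‖M‖_∞ is the maximum absolute row sum of M. -/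
/-- The absolute value of a determinant is at most the product of the absolute row sums. -/
theorem Matrix.abs_det_le_prod_sum_abs {ι R : Type*} [Fintype ι] [DecidableEq ι]
    [CommRing R] [LinearOrder R] [IsStrictOrderedRing R] (A : Matrix ι ι R) :
    |A.det| ≤ ∏ i, ∑ j, |A i j| := by
  rw [← Matrix.det_transpose, Matrix.det_apply, Finset.prod_univ_sum, Fintype.piFinset_univ]
  calc |∑ σ : Equiv.Perm ι, Equiv.Perm.sign σ • ∏ i, A.transpose (σ i) i|
      ≤ ∑ σ : Equiv.Perm ι, ∏ i, |A i (σ i)| := by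
        refine (Finset.abs_sum_le_sum_abs _ _).trans (Finset.sum_le_sum fun σ _ => ?_)
        rcases Int.units_eq_one_or (Equiv.Perm.sign σ) with h | h <;>
          simp [h, Finset.abs_prod]
    _ = ∑ f ∈ Finset.univ.map ⟨fun σ : Equiv.Perm ι => (σ : ι → ι), DFunLike.coe_injective⟩,
          ∏ i, |A i (f i)| := by simp
    _ ≤ ∑ f : ι → ι, ∏ i, |A i (f i)| :=
        Finset.sum_le_sum_of_subset_of_nonneg (Finset.subset_univ _)
          fun f _ _ => Finset.prod_nonneg fun i _ => abs_nonneg _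

/-- The absolute value of a principal minor is at most the product of the absolute row sums
of the corresponding principal submatrix. -/
theorem Matrix.abs_det_toSquareBlockProp_le {ι R : Type*} [Fintype ι] [DecidableEq ι]
    [CommRing R] [LinearOrder R] [IsStrictOrderedRing R] (A : Matrix ι ι R)
    (p : ι → Prop) [DecidablePred p] :
    |(A.toSquareBlockProp p).det| ≤ ∏ i with p i, ∑ j with p j, |A i j| := by
  refine (Matrix.abs_det_le_prod_sum_abs _).trans_eq ?_
  rw [Finset.prod_subtype (Finset.univ.filter p) (p := p) (by simp)]
  refine Finset.prod_congr rfl fun i _ => ?_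
  rw [Finset.sum_subtype (Finset.univ.filter p) (p := p) (by simp)]
  rfl

/-- Let `M` be an `n×n` real matrix and `J ⊆ [n]`.  Let `M_J` be the matrix
whose `j`-th column is the `j`-th standard basis vector if `j ∉ J` and the `j`-th column of `M`
if `j ∈ J`.  Then `|det M_J| ≤ ‖M‖_∞^{|J|}`, where `‖M‖_∞` is the maximum absolute row sum
(formalized by quantifying over all upper bounds `c` for the row sums). -/
theorem abs_det_column_replace_le (n : ℕ) (M : Matrix (Fin n) (Fin n) ℝ)
    (J : Finset (Fin n)) (c : ℝ) (hc : ∀ i, ∑ j, |M i j| ≤ c) :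
    |(Matrix.of fun i j : Fin n => if j ∈ J then M i j else if i = j then (1 : ℝ) else 0).det| ≤
      c ^ J.card := by
  set A : Matrix (Fin n) (Fin n) ℝ :=
    Matrix.of fun i j : Fin n => if j ∈ J then M i j else if i = j then (1 : ℝ) else 0 with hA
  have hone : A.toSquareBlockProp (fun i => ¬i ∈ J) = 1 := by
    ext ⟨i, hi⟩ ⟨j, hj⟩
    simp [Matrix.toSquareBlockProp, hA, hj, Matrix.one_apply]
  rw [Matrix.twoBlockTriangular_det' A (fun i => i ∈ J), hone, Matrix.det_one, mul_one]
  · refine (Matrix.abs_det_toSquareBlockProp_le A _).trans ?_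
    rw [Finset.filter_univ_mem, ← Finset.prod_const]
    refine Finset.prod_le_prod
      (fun i _ => Finset.sum_nonneg fun j _ => abs_nonneg _) fun i _ => ?_
    calc ∑ j ∈ J, |A i j| = ∑ j ∈ J, |M i j| :=
          Finset.sum_congr rfl fun j hj => by simp [hA, hj]
      _ ≤ ∑ j, |M i j| :=
          Finset.sum_le_sum_of_subset_of_nonneg (Finset.subset_univ _)
            fun j _ _ => abs_nonneg _
      _ ≤ c := hc i
  · intro i hi j hj
    have hij : i ≠ j := fun h => hj (h ▸ hi)
    simp [hA, hj, hij]
end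

section
/- Let G be a finite simple graph with n vertices and average degree d = 2|E(G)|/n. Then for every nonnegative integer h with h ≤ d, there exists a subgraph H of G with at least hd/2 edges in which every vertex has degree at most h. -/
/-- The spanning subgraph of `G` formed by the edges `uv` for which the translate of
`e u + e v` by `-t` lies in `S`. -/
def SimpleGraph.sumSubgraph {V A : Type*} [AddCommGroup A] (G : SimpleGraph V) (e : V → A)
    (S : Finset A) (t : A) : SimpleGraph V where
  Adj u v := G.Adj u v ∧ e u + e v - t ∈ S
  symm := ⟨fun u v huv => ⟨huv.1.symm, by rw [add_comm]; exact huv.2⟩⟩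
  loopless := ⟨fun v hv => G.irrefl hv.1⟩

theorem SimpleGraph.ncard_neighborSet_sumSubgraph_le {V A : Type*} [AddCommGroup A]
    (G : SimpleGraph V) {e : V → A} (he : Function.Injective e) (S : Finset A) (t : A) (v : V) :
    ((G.sumSubgraph e S t).neighborSet v).ncard ≤ S.card := by
  rw [← Set.ncard_coe_finset S]
  refine Set.ncard_le_ncard_of_injOn (fun w => e v + e w - t) (fun w hw => hw.2) ?_
  intro w _ w' _ hww
  exact he (by simpa using hww)

open Classical in
theorem SimpleGraph.sum_ncard_edgeSet_sumSubgraph {V A : Type*} [Fintype V] [AddCommGroup A]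
    [Fintype A] (G : SimpleGraph V) (e : V → A) (S : Finset A) :
    ∑ t, (G.sumSubgraph e S t).edgeSet.ncard = S.card * G.edgeSet.ncard := by
  let c : Sym2 V → A := Sym2.lift ⟨fun u v => e u + e v, fun u v => add_comm _ _⟩
  have hedge (t : A) : (G.sumSubgraph e S t).edgeSet.ncard =
      ∑ x ∈ G.edgeFinset, if c x - t ∈ S then 1 else 0 := by
    rw [← Finset.card_filter, ← Set.ncard_coe_finset]
    congr 1
    ext x
    induction x with
    | _ u v => simp [c, SimpleGraph.sumSubgraph]
  have hcount (a : A) : ∑ t, (if a - t ∈ S then 1 else 0) = S.card := by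
    have hshift := (Equiv.subLeft a).sum_comp (fun s => if s ∈ S then 1 else 0)
    simpa only [Equiv.subLeft_apply, Finset.sum_boole, Finset.filter_univ_mem, Nat.cast_id]
      using hshift
  simp_rw [hedge]
  rw [Finset.sum_comm]
  simp_rw [hcount]
  rw [Finset.sum_const, smul_eq_mul, mul_comm, ← Set.ncard_coe_finset G.edgeFinset, G.coe_edgeFinset]

theorem SimpleGraph.two_mul_ncard_edgeSet_le {V : Type*} [Fintype V] (G : SimpleGraph V) :
    2 * G.edgeSet.ncard ≤ Fintype.card V * Fintype.card V := by
  classical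
  rw [← G.coe_edgeFinset, Set.ncard_coe_finset, ← G.sum_degrees_eq_twice_card_edges]
  calc ∑ v, G.degree v ≤ ∑ _v : V, Fintype.card V :=
        Finset.sum_le_sum fun v _ => (G.degree_lt_card_verts v).le
    _ = Fintype.card V * Fintype.card V := by simp

/-- Let `G` be a finite simple graph with `n` vertices and average degree
`d = 2|E(G)|/n`.  Then for every nonnegative integer `h ≤ d` there is a subgraph of `G` with at
least `hd/2` edges whose degrees are all at most `h`. -/
theorem exists_subgraph_bounded_degree_many_edges {V : Type*} [Fintype V]
    (G : SimpleGraph V) (h : ℕ)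
    (hd : (h : ℝ) ≤ 2 * (G.edgeSet.ncard : ℝ) / (Fintype.card V : ℝ)) :
    ∃ H : SimpleGraph V, H ≤ G ∧
      (h : ℝ) * (2 * (G.edgeSet.ncard : ℝ) / (Fintype.card V : ℝ)) / 2 ≤ (H.edgeSet.ncard : ℝ) ∧
      ∀ v, (H.neighborSet v).ncard ≤ h := by
  rcases Nat.eq_zero_or_pos (Fintype.card V) with hn | hn
  · exact ⟨⊥, bot_le, by simp [hn], fun v => by simp [SimpleGraph.neighborSet]⟩
  have hn' : (0 : ℝ) < Fintype.card V := by exact_mod_cast hn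
  have : NeZero (Fintype.card V) := ⟨hn.ne'⟩
  have hle : h ≤ Fintype.card V := by
    rw [le_div_iff₀ hn'] at hd
    have hm : (h : ℝ) * Fintype.card V ≤ Fintype.card V * Fintype.card V :=
      hd.trans (by exact_mod_cast G.two_mul_ncard_edgeSet_le)
    exact_mod_cast le_of_mul_le_mul_right hm hn'
  let e : V ≃ ZMod (Fintype.card V) := Fintype.equivOfCardEq (ZMod.card _).symm
  obtain ⟨S, -, hS⟩ := Finset.exists_subset_card_eq
    (s := (Finset.univ : Finset (ZMod (Fintype.card V)))) (n := h)
    (by rwa [Finset.card_univ, ZMod.card])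
  obtain ⟨t, -, ht⟩ := Finset.exists_le_of_sum_le (s := Finset.univ)
    (f := fun _ : ZMod (Fintype.card V) => (h * G.edgeSet.ncard : ℝ) / Fintype.card V)
    (g := fun t => ((G.sumSubgraph e S t).edgeSet.ncard : ℝ)) Finset.univ_nonempty (by
      rw [← Nat.cast_sum, G.sum_ncard_edgeSet_sumSubgraph, hS, Finset.sum_const,
        Finset.card_univ, ZMod.card, nsmul_eq_mul, mul_div_cancel₀ _ hn'.ne']
      push_cast
      rfl)
  refine ⟨G.sumSubgraph e S t, fun u v huv => huv.1, ?_, fun v => ?_⟩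
  · calc _ = (h * G.edgeSet.ncard : ℝ) / Fintype.card V := by ring
      _ ≤ _ := ht
  · rw [← hS]
    exact G.ncard_neighborSet_sumSubgraph_le e.injective S t v
end

section
/- Let τ_Q > 0 be fixed and let G be a simple graph with n vertices such that q(G) ≥ τ_Q n, where q(G) is the least eigenvalue of the signless Laplacian of G. Let U be a nonempty set of vertices of G, and define L := 1 + 2⌈log_{1+τ_Q}(2/τ_Q)⌉. Then there exist at least τ_Q n |U| / (8L) walks in G, each of odd length at most L and with both endpoints in U, that are pairwise edge-disjoint (no edge of G is used by two different walks). -/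
open scoped BigOperators Classical

/-- The vertices reached from `U` by a walk of length less than `i` and of the parity of `i - 1`. -/
noncomputable def walkLayer {V : Type*} [Fintype V] (H : SimpleGraph V) (U : Finset V) :
    ℕ → Finset V
  | 0 => ∅
  | 1 => U
  | i + 2 => walkLayer H U i ∪ Finset.univ.filter fun v => ∃ u ∈ walkLayer H U (i + 1), H.Adj u v

section WalkLayer

variable {V : Type*} [Fintype V] {H : SimpleGraph V} {U : Finset V}

lemma walkLayer_subset_add_two (i : ℕ) : walkLayer H U i ⊆ walkLayer H U (i + 2) := by
  rw [walkLayer]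
  exact Finset.subset_union_left

lemma mem_walkLayer_succ_of_adj {i : ℕ} {x y : V} (hx : x ∈ walkLayer H U i) (h : H.Adj x y) :
    y ∈ walkLayer H U (i + 1) := by
  cases i with
  | zero => simp [walkLayer] at hx
  | succ i =>
    rw [walkLayer]
    exact Finset.mem_union_right _ (by simpa using ⟨x, hx, h⟩)

lemma exists_walk_of_mem_walkLayer (i : ℕ) {v : V} (hv : v ∈ walkLayer H U i) :
    ∃ u ∈ U, ∃ p : H.Walk u v, p.length + 1 ≤ i ∧ Odd (p.length + i) := by
  induction i using Nat.strong_induction_on generalizing v with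
  | _ i ih =>
    match i, ih, hv with
    | 0, _, hv => simp [walkLayer] at hv
    | 1, _, hv =>
      rw [walkLayer] at hv
      exact ⟨v, hv, .nil, by simp, by simp⟩
    | i + 2, ih, hv =>
      rw [walkLayer, Finset.mem_union] at hv
      rcases hv with hv | hv
      · obtain ⟨u, hu, p, hp, ho⟩ := ih i (by omega) hv
        exact ⟨u, hu, p, by omega, by grind⟩
      · obtain ⟨w, hw, hwv⟩ : ∃ w ∈ walkLayer H U (i + 1), H.Adj w v := by simpa using hv
        obtain ⟨u, hu, p, hp, ho⟩ := ih (i + 1) (by omega) hw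
        refine ⟨u, hu, p.concat hwv, ?_, ?_⟩ <;> rw [SimpleGraph.Walk.length_concat]
        · omega
        · grind

lemma not_adj_of_mem_walkLayer {K i : ℕ} (hi : i ≤ K + 1)
    (h : ∀ u ∈ U, ∀ v ∈ U, ∀ p : H.Walk u v, Odd p.length → ¬ p.length ≤ 2 * K + 1)
    {x y : V} (hx : x ∈ walkLayer H U i) (hy : y ∈ walkLayer H U i) : ¬ H.Adj x y := by
  intro hxy
  obtain ⟨u, hu, p, hp, hpo⟩ := exists_walk_of_mem_walkLayer i hx
  obtain ⟨v, hv, q, hq, hqo⟩ := exists_walk_of_mem_walkLayer i hy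
  have hl : ((p.concat hxy).append q.reverse).length = p.length + 1 + q.length := by simp
  refine h u hu v hv ((p.concat hxy).append q.reverse) ?_ ?_ <;> rw [hl]
  · grind
  · omega

lemma disjoint_walkLayer_succ {K i : ℕ} (hi : i ≤ K + 1)
    (h : ∀ u ∈ U, ∀ v ∈ U, ∀ p : H.Walk u v, Odd p.length → ¬ p.length ≤ 2 * K + 1) :
    Disjoint (walkLayer H U i) (walkLayer H U (i + 1)) := by
  refine Finset.disjoint_left.2 fun x hx hy => ?_
  obtain ⟨u, hu, p, hp, hpo⟩ := exists_walk_of_mem_walkLayer i hx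
  obtain ⟨v, hv, q, hq, hqo⟩ := exists_walk_of_mem_walkLayer (i + 1) hy
  have hl : (p.append q.reverse).length = p.length + q.length := by simp
  refine h u hu v hv (p.append q.reverse) ?_ ?_ <;> rw [hl]
  · grind
  · omega

/-- The quadratic form of the signless Laplacian of `H`, evaluated at the difference of the
indicators of two consecutive layers. -/
lemma sum_walkLayer_le {i : ℕ}
    (hdisj : Disjoint (walkLayer H U i) (walkLayer H U (i + 1)))
    (h₀ : ∀ x ∈ walkLayer H U i, ∀ y ∈ walkLayer H U i, ¬ H.Adj x y)
    (h₁ : ∀ x ∈ walkLayer H U (i + 1), ∀ y ∈ walkLayer H U (i + 1), ¬ H.Adj x y)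
    {θ : V → ℝ} (hθ : θ = fun x => (if x ∈ walkLayer H U i then (1 : ℝ) else 0) -
      if x ∈ walkLayer H U (i + 1) then 1 else 0) :
    (∑ x, ∑ y, if H.Adj x y then (θ x + θ y) ^ 2 else 0) ≤
      2 * ((walkLayer H U (i + 1)).card *
        ((walkLayer H U (i + 2)).card - (walkLayer H U i).card : ℝ)) := by
  set A := walkLayer H U i with hA
  set B := walkLayer H U (i + 1) with hB
  set D := walkLayer H U (i + 2) \ A with hD
  have hDcard : (D.card : ℝ) = (walkLayer H U (i + 2)).card - A.card := by
    rw [hD, Finset.card_sdiff_of_subset (walkLayer_subset_add_two i),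
      Nat.cast_sub (Finset.card_le_card (walkLayer_subset_add_two i))]
  have hpt : ∀ x y, (if H.Adj x y then (θ x + θ y) ^ 2 else 0) ≤
      (if x ∈ B then (1 : ℝ) else 0) * (if y ∈ D then (1 : ℝ) else 0) +
      (if x ∈ D then (1 : ℝ) else 0) * (if y ∈ B then (1 : ℝ) else 0) := by
    intro x y
    by_cases hxy : H.Adj x y
    · have e1 : x ∈ A → y ∈ B := fun hx => mem_walkLayer_succ_of_adj hx hxy
      have e2 : y ∈ A → x ∈ B := fun hy => mem_walkLayer_succ_of_adj hy hxy.symm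
      have e3 : x ∈ B → y ∉ A → y ∈ D := fun hx hy =>
        Finset.mem_sdiff.2 ⟨mem_walkLayer_succ_of_adj hx hxy, hy⟩
      have e4 : y ∈ B → x ∉ A → x ∈ D := fun hy hx =>
        Finset.mem_sdiff.2 ⟨mem_walkLayer_succ_of_adj hy hxy.symm, hx⟩
      have e5 : x ∈ A → y ∉ A := fun hx hy => h₀ x hx y hy hxy
      have e6 : x ∈ B → y ∉ B := fun hx hy => h₁ x hx y hy hxy
      have e7 : x ∈ A → x ∉ B := fun hx => Finset.disjoint_left.1 hdisj hx
      have e8 : y ∈ A → y ∉ B := fun hx => Finset.disjoint_left.1 hdisj hx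
      have e9 : x ∈ D → x ∉ A := fun hx => (Finset.mem_sdiff.1 hx).2
      have e10 : y ∈ D → y ∉ A := fun hx => (Finset.mem_sdiff.1 hx).2
      simp only [hθ, hxy, if_true]
      by_cases xA : x ∈ A <;> by_cases xB : x ∈ B <;> by_cases yA : y ∈ A <;>
        by_cases yB : y ∈ B <;> simp_all
    · rw [if_neg hxy]
      positivity
  refine (Finset.sum_le_sum fun x _ => Finset.sum_le_sum fun y _ => hpt x y).trans (le_of_eq ?_)
  simp only [Finset.sum_add_distrib, ← Finset.mul_sum, ← Finset.sum_mul]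
  simp only [Finset.sum_ite_mem, Finset.univ_inter, Finset.sum_const, nsmul_eq_mul, mul_one]
  rw [hDcard]
  ring

end WalkLayer

/-- Deleting a set `F` of edges lowers the signless Laplacian form by at most `4 |F|` at a vector
with entries in `[-1, 1]`. -/
lemma sum_le_sum_deleteEdges_add {V : Type*} [Fintype V] {G H : SimpleGraph V}
    {F : Finset (Sym2 V)} (hH : G.deleteEdges F ≤ H) {θ : V → ℝ} (hθ : ∀ x, |θ x| ≤ 1) :
    (∑ x, ∑ y, if G.Adj x y then (θ x + θ y) ^ 2 else 0) ≤
      (∑ x, ∑ y, if H.Adj x y then (θ x + θ y) ^ 2 else 0) + 8 * F.card := by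
  have hpt : ∀ x y, (if G.Adj x y then (θ x + θ y) ^ 2 else 0) ≤
      (if H.Adj x y then (θ x + θ y) ^ 2 else 0) +
        4 * if s(x, y) ∈ F then (1 : ℝ) else 0 := by
    intro x y
    have h4 : (θ x + θ y) ^ 2 ≤ 4 := by
      have := abs_le.1 (hθ x)
      have := abs_le.1 (hθ y)
      nlinarith
    have h0 := sq_nonneg (θ x + θ y)
    have h1 : G.Adj x y → s(x, y) ∉ F → H.Adj x y := fun h hF =>
      hH (SimpleGraph.deleteEdges_adj.2 ⟨h, by simpa using hF⟩)
    split_ifs <;> first | linarith | exact absurd (h1 ‹_› ‹_›) ‹_›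
  have hcount : (∑ x, ∑ y, if s(x, y) ∈ F then (1 : ℝ) else 0) ≤ 2 * F.card := by
    have hfiber : ∀ e ∈ F, (Finset.univ.filter fun p : V × V => s(p.1, p.2) = e).card ≤ 2 := by
      intro e _
      induction e with
      | _ a b =>
        refine (Finset.card_le_card (t := {(a, b), (b, a)}) fun p hp => ?_).trans
          Finset.card_le_two
        simpa [Prod.ext_iff] using hp
    have := Finset.card_le_mul_card_image_of_maps_to
      (s := Finset.univ.filter fun p : V × V => s(p.1, p.2) ∈ F) (t := F)
      (f := fun p => s(p.1, p.2)) (by simp) 2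
      (fun e he => (Finset.card_le_card (by
        intro p hp
        simp only [Finset.mem_filter, Finset.mem_univ, true_and] at hp ⊢
        exact hp.2)).trans (hfiber e he))
    rw [← Fintype.sum_prod_type' (fun x y => if s(x, y) ∈ F then (1 : ℝ) else 0),
      Finset.sum_boole]
    exact_mod_cast this
  calc _ ≤ _ := Finset.sum_le_sum fun x _ => Finset.sum_le_sum fun y _ => hpt x y
    _ ≤ _ := by
      simp only [Finset.sum_add_distrib, ← Finset.mul_sum]
      linarith

lemma growth_two_steps {τ n a b s d d' : ℝ} (hτ : 0 < τ) (hn : 0 < n) (ha : 0 < a) (hb : 0 < b)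
    (hs : 0 ≤ s) (hab : a + b ≤ n) (h₁ : τ * n * (s / 2) ≤ a * d)
    (h₂ : τ * n * ((s + d) / 2) ≤ b * d') : (1 + τ) ^ 2 * s ≤ s + d + d' := by
  have hd : τ * (n / (2 * a)) * s ≤ d := by
    rw [← mul_le_mul_iff_right₀ ha]
    refine le_trans (le_of_eq ?_) h₁
    field_simp
  have hd' : τ * (n / (2 * b)) * (s + d) ≤ d' := by
    rw [← mul_le_mul_iff_right₀ hb]
    refine le_trans (le_of_eq ?_) h₂
    field_simp
  set p := n / (2 * a) with hp
  set q := n / (2 * b) with hq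
  have hp0 : 0 < p := by positivity
  have hq0 : 0 < q := by positivity
  have hpq : 1 ≤ p * q := by
    rw [hp, hq, div_mul_div_comm, one_le_div (by positivity)]
    nlinarith [sq_nonneg (a - b), mul_self_le_mul_self (by positivity) hab]
  have hsum : 2 ≤ p + q := by nlinarith [sq_nonneg (p - q)]
  calc (1 + τ) ^ 2 * s ≤ (1 + τ * q) * ((1 + τ * p) * s) := by
        have : (1 + τ) ^ 2 ≤ (1 + τ * q) * (1 + τ * p) := by
          nlinarith [mul_le_mul_of_nonneg_left hsum hτ.le,
            mul_le_mul_of_nonneg_left hpq (sq_nonneg τ)]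
        nlinarith [mul_le_mul_of_nonneg_right this hs]
    _ ≤ (1 + τ * q) * (s + d) := by
        refine mul_le_mul_of_nonneg_left (by linarith) (by positivity)
    _ ≤ s + d + d' := by linarith

/-- Sums of consecutive terms of a sequence satisfying the layer expansion inequality grow
geometrically. -/
lemma lt_add_succ_of_expansion {τ n : ℝ} (hτ : 0 < τ) (hτ2 : τ ≤ 2) (hn : 0 < n)
    {K : ℕ} {c : ℕ → ℝ}
    (h0 : c 0 = 0) (h1 : 0 < c 1) (hmono : ∀ i, c i ≤ c (i + 2))
    (hsum : ∀ i ≤ K + 1, c i + c (i + 1) ≤ n)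
    (hstep : ∀ i ≤ K, τ * n * (c i + c (i + 1) - c 1 / 2) ≤ c (i + 1) * (c (i + 2) - c i)) :
    ∀ i ≤ K, (1 + τ) ^ i * (τ * n / 2) < c (i + 1) + c (i + 2) := by
  have hτn : 0 < τ * n := by positivity
  have h2 : τ * n / 2 ≤ c 2 := by
    have := hstep 0 (by omega)
    rw [← mul_le_mul_iff_right₀ h1]
    simp only [h0, zero_add] at this
    linarith
  have hpos : ∀ i, 0 < c (i + 1) ∧ 0 < c (i + 2) := by
    intro i
    induction i with
    | zero => exact ⟨h1, by linarith⟩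
    | succ i ih => exact ⟨ih.2, ih.1.trans_le (hmono (i + 1))⟩
  have hs1 : ∀ i, c 1 ≤ c (i + 1) + c (i + 2) := by
    intro i
    induction i with
    | zero => linarith
    | succ i ih => linarith [hmono (i + 1)]
  intro i
  induction i using Nat.strong_induction_on with
  | _ i ih =>
    match i, ih with
    | 0, _ => intro _; simp; linarith
    | 1, _ =>
      intro hK
      have := hstep 1 hK
      have h3 : τ * n ≤ c 3 - c 1 := by
        rw [← mul_le_mul_iff_right₀ (hpos 0).2]
        norm_num at this ⊢
        nlinarith
      norm_num
      nlinarith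
    | i + 2, ih =>
      intro hK
      have e1 := hstep (i + 1) (by omega)
      have e2 := hstep (i + 2) (by omega)
      have e3 := ih i (by omega) (by omega)
      have e4 := growth_two_steps (s := c (i + 1) + c (i + 2)) (d := c (i + 3) - c (i + 1))
        (d' := c (i + 4) - c (i + 2)) hτ hn (hpos i).2 (hpos (i + 1)).2
        (by linarith [hs1 i]) (hsum (i + 2) (by omega))
        (le_trans (mul_le_mul_of_nonneg_left (by linarith [hs1 i]) hτn.le) e1)
        (le_trans (mul_le_mul_of_nonneg_left (by linarith [hs1 (i + 1)]) hτn.le) e2)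
      calc (1 + τ) ^ (i + 2) * (τ * n / 2) = (1 + τ) ^ 2 * ((1 + τ) ^ i * (τ * n / 2)) := by ring
        _ < (1 + τ) ^ 2 * (c (i + 1) + c (i + 2)) := by gcongr
        _ ≤ _ := e4.trans (by ring_nf; rfl)

/-- An odd walk between vertices of `U` survives the deletion of few edges. -/
lemma exists_odd_walk_deleteEdges {V : Type*} [Fintype V] {τ : ℝ} (hτ : 0 < τ) (hτ2 : τ ≤ 2)
    {G : SimpleGraph V}
    (hq : ∀ θ : V → ℝ, τ * Fintype.card V * ∑ j, (θ j) ^ 2 ≤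
      (1 / 2) * ∑ j, ∑ k, if G.Adj j k then (θ j + θ k) ^ 2 else 0)
    {U : Finset V} (hU : U.Nonempty) {K : ℕ} (hK : 2 / τ ≤ (1 + τ) ^ K)
    {F : Finset (Sym2 V)} (hF : 8 * (F.card : ℝ) ≤ τ * Fintype.card V * U.card) :
    ∃ u ∈ U, ∃ v ∈ U, ∃ p : (G.deleteEdges F).Walk u v, Odd p.length ∧ p.length ≤ 2 * K + 1 := by
  by_contra! hcon
  set H := G.deleteEdges F
  have hno : ∀ u ∈ U, ∀ v ∈ U, ∀ p : H.Walk u v, Odd p.length → ¬ p.length ≤ 2 * K + 1 :=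
    fun u hu v hv p hp => not_le.2 (hcon u hu v hv p hp)
  have : Nonempty V := ⟨hU.choose⟩
  have hn : (0 : ℝ) < Fintype.card V := by exact_mod_cast Fintype.card_pos
  have hsum : ∀ i ≤ K + 1, ((walkLayer H U i).card : ℝ) + (walkLayer H U (i + 1)).card ≤
      Fintype.card V := by
    intro i hi
    have := Finset.card_le_univ (walkLayer H U i ∪ walkLayer H U (i + 1))
    rw [Finset.card_union_of_disjoint (disjoint_walkLayer_succ hi hno)] at this
    exact_mod_cast this
  have key := lt_add_succ_of_expansion hτ hτ2 hn (K := K)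
    (c := fun i => ((walkLayer H U i).card : ℝ)) (by simp [walkLayer])
    (by simpa [walkLayer] using hU)
    (fun i => by exact_mod_cast Finset.card_le_card (walkLayer_subset_add_two i)) hsum ?_ K le_rfl
  · have h1 := hsum (K + 1) le_rfl
    have h2 := mul_le_mul_of_nonneg_right hK (by positivity : 0 ≤ τ * Fintype.card V / 2)
    have h3 : 2 / τ * (τ * Fintype.card V / 2) = (Fintype.card V : ℝ) := by field_simp
    linarith
  · intro i hi
    have hdisj := disjoint_walkLayer_succ (i := i) (by omega) hno
    set θ : V → ℝ := fun x => (if x ∈ walkLayer H U i then (1 : ℝ) else 0) -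
      if x ∈ walkLayer H U (i + 1) then 1 else 0 with hθ
    have hsq : ∑ x, θ x ^ 2 = (walkLayer H U i).card + (walkLayer H U (i + 1)).card := by
      have : ∀ x, θ x ^ 2 = (if x ∈ walkLayer H U i then (1 : ℝ) else 0) +
          if x ∈ walkLayer H U (i + 1) then 1 else 0 := by
        intro x
        have hx : x ∈ walkLayer H U i → x ∉ walkLayer H U (i + 1) :=
          fun hx => Finset.disjoint_left.1 hdisj hx
        simp only [hθ]
        split_ifs <;> simp_all
      simp [this, Finset.sum_add_distrib]
    have habs : ∀ x, |θ x| ≤ 1 := by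
      intro x
      simp only [hθ]
      split_ifs <;> norm_num
    have e1 := hq θ
    have e2 := sum_le_sum_deleteEdges_add (le_refl H) habs
    have e3 := sum_walkLayer_le hdisj
      (fun x hx y hy => not_adj_of_mem_walkLayer (by omega) hno hx hy)
      (fun x hx y hy => not_adj_of_mem_walkLayer (by omega) hno hx hy) hθ
    rw [hsq] at e1
    have e4 : (walkLayer H U 1).card = U.card := by rw [walkLayer]
    rw [e4]
    linarith

lemma le_two_of_forall_le_sum {V : Type*} [Fintype V] [Nonempty V] {τ : ℝ} {G : SimpleGraph V}
    (hq : ∀ θ : V → ℝ, τ * Fintype.card V * ∑ j, (θ j) ^ 2 ≤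
      (1 / 2) * ∑ j, ∑ k, if G.Adj j k then (θ j + θ k) ^ 2 else 0) : τ ≤ 2 := by
  have hn : (0 : ℝ) < Fintype.card V := by exact_mod_cast Fintype.card_pos
  have h := (hq fun _ => 1).trans (mul_le_mul_of_nonneg_left
    (Finset.sum_le_sum (g := fun _ => ∑ _ : V, (4 : ℝ)) fun j _ =>
      Finset.sum_le_sum fun k _ => by split_ifs <;> norm_num) (by norm_num))
  simp only [Finset.sum_const, Finset.card_univ, nsmul_eq_mul, one_pow, mul_one] at h
  refine le_of_mul_le_mul_right ?_ (mul_pos hn hn)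
  linarith

/-- Short odd walks with endpoints in `U` can be chosen edge-disjointly one after another. -/
lemma exists_edgeDisjoint_odd_walks {V : Type*} [Fintype V] {τ : ℝ} (hτ : 0 < τ) (hτ2 : τ ≤ 2)
    {G : SimpleGraph V}
    (hq : ∀ θ : V → ℝ, τ * Fintype.card V * ∑ j, (θ j) ^ 2 ≤
      (1 / 2) * ∑ j, ∑ k, if G.Adj j k then (θ j + θ k) ^ 2 else 0)
    {U : Finset V} (hU : U.Nonempty) {K : ℕ} (hK : 2 / τ ≤ (1 + τ) ^ K) (N : ℕ)
    (hN : ∀ M < N, 8 * ((M * (2 * K + 1) : ℕ) : ℝ) ≤ τ * Fintype.card V * U.card) :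
    ∃ w : Fin N → Σ u : V, Σ v : V, G.Walk u v,
      (∀ i, Odd (w i).2.2.length ∧ (w i).2.2.length ≤ 2 * K + 1 ∧ (w i).1 ∈ U ∧ (w i).2.1 ∈ U) ∧
      (∀ i i', i ≠ i' → ∀ e, e ∈ (w i).2.2.edges → e ∉ (w i').2.2.edges) := by
  induction N with
  | zero => exact ⟨fun i => i.elim0, fun i => i.elim0, fun i => i.elim0⟩
  | succ N ih =>
    obtain ⟨w, hw, hdisj⟩ := ih fun M hM => hN M (by omega)
    set F : Finset (Sym2 V) := Finset.univ.biUnion fun i => (w i).2.2.edges.toFinset with hF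
    have hFcard : F.card ≤ N * (2 * K + 1) := by
      have := Finset.card_biUnion_le_card_mul Finset.univ
        (fun i => (w i).2.2.edges.toFinset) (2 * K + 1) fun i _ =>
          (List.toFinset_card_le _).trans (by simpa using (hw i).2.1)
      simpa using this
    have hFcard' : (F.card : ℝ) ≤ ((N * (2 * K + 1) : ℕ) : ℝ) := by exact_mod_cast hFcard
    obtain ⟨u, hu, v, hv, p, hp, hpl⟩ := exists_odd_walk_deleteEdges hτ hτ2 hq hU hK (F := F)
      (by linarith [hN N (by omega)])
    have hpe : ∀ i, ∀ e ∈ p.edges, e ∉ (w i).2.2.edges := by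
      intro i e he hei
      have h1 := p.edges_subset_edgeSet he
      rw [SimpleGraph.edgeSet_deleteEdges] at h1
      exact h1.2 (Finset.mem_coe.2
        (Finset.mem_biUnion.2 ⟨i, Finset.mem_univ _, List.mem_toFinset.2 hei⟩))
    have hle : G.deleteEdges (F : Set (Sym2 V)) ≤ G := SimpleGraph.deleteEdges_le _
    refine ⟨Fin.cons (α := fun _ => Σ u : V, Σ v : V, G.Walk u v) ⟨u, v, p.mapLe hle⟩ w, ?_, ?_⟩
    · intro i
      cases i using Fin.cases with
      | zero =>
        change Odd (p.mapLe hle).length ∧ (p.mapLe hle).length ≤ 2 * K + 1 ∧ u ∈ U ∧ v ∈ U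
        rw [SimpleGraph.Walk.length_map]
        exact ⟨hp, hpl, hu, hv⟩
      | succ i => exact hw i
    · intro i i' hii' e he he'
      cases i using Fin.cases with
      | zero =>
        cases i' using Fin.cases with
        | zero => exact hii' rfl
        | succ i' =>
          change e ∈ (p.mapLe hle).edges at he
          rw [SimpleGraph.Walk.edges_mapLe_eq_edges] at he
          exact hpe i' e he he'
      | succ i =>
        cases i' using Fin.cases with
        | zero =>
          change e ∈ (p.mapLe hle).edges at he'
          rw [SimpleGraph.Walk.edges_mapLe_eq_edges] at he'
          exact hpe i e he' he
        | succ i' => exact hdisj i i' (fun h => hii' (by rw [h])) e he he'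

/-- Let `τ_Q > 0` and let `G` be a graph on `n` vertices whose signless
Laplacian has least eigenvalue at least `τ_Q n` (expressed via its quadratic form
`Σ_{jk∈E}(θ_j+θ_k)² ≥ τ_Q n Σ θ_j²`).  Let `U` be a nonempty vertex set and
`L := 1 + 2⌈log_{1+τ_Q}(2/τ_Q)⌉`.  Then there are at least `τ_Q n |U|/(8L)` pairwise
edge-disjoint walks of odd length at most `L` with both endpoints in `U`. -/
theorem exists_many_odd_walks (τQ : ℝ) (hτ : 0 < τQ) (n : ℕ) (G : SimpleGraph (Fin n))
    (hq : ∀ θ : Fin n → ℝ,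
      τQ * n * ∑ j, (θ j) ^ 2 ≤
        (1 / 2) * ∑ j, ∑ k, if G.Adj j k then (θ j + θ k) ^ 2 else 0)
    (U : Finset (Fin n)) (hU : U.Nonempty) :
    ∃ (N : ℕ) (w : Fin N → Σ u : Fin n, Σ v : Fin n, G.Walk u v),
      τQ * n * (U.card : ℝ) /
          (8 * (1 + 2 * ((⌈Real.logb (1 + τQ) (2 / τQ)⌉ : ℤ) : ℝ))) ≤ (N : ℝ) ∧
      (∀ i, Odd (w i).2.2.length ∧
        ((w i).2.2.length : ℝ) ≤ 1 + 2 * ((⌈Real.logb (1 + τQ) (2 / τQ)⌉ : ℤ) : ℝ) ∧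
        (w i).1 ∈ U ∧ (w i).2.1 ∈ U) ∧
      (∀ i i', i ≠ i' → ∀ e, e ∈ (w i).2.2.edges → e ∉ (w i').2.2.edges) := by
  have : Nonempty (Fin n) := ⟨hU.choose⟩
  have hq' : ∀ θ : Fin n → ℝ, τQ * Fintype.card (Fin n) * ∑ j, (θ j) ^ 2 ≤
      (1 / 2) * ∑ j, ∑ k, if G.Adj j k then (θ j + θ k) ^ 2 else 0 := by simpa using hq
  have hτ2 : τQ ≤ 2 := le_two_of_forall_le_sum hq'
  have hlog : 0 ≤ Real.logb (1 + τQ) (2 / τQ) :=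
    Real.logb_nonneg (by linarith) ((one_le_div hτ).2 hτ2)
  obtain ⟨K, hKc⟩ := Int.eq_ofNat_of_zero_le (Int.ceil_nonneg hlog)
  have hK : 2 / τQ ≤ (1 + τQ) ^ K := by
    have h := Int.le_ceil (Real.logb (1 + τQ) (2 / τQ))
    rw [hKc, Real.logb_le_iff_le_rpow (by linarith) (by positivity)] at h
    simpa using h
  rw [hKc, Int.cast_natCast]
  set T := τQ * n * (U.card : ℝ) / (8 * (1 + 2 * (K : ℝ))) with hT
  obtain ⟨w, hw, hdisj⟩ := exists_edgeDisjoint_odd_walks hτ hτ2 hq' hU hK ⌈T⌉₊ (by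
    intro M hM
    have h := (Nat.lt_ceil.1 hM).le
    rw [hT, le_div_iff₀ (by positivity)] at h
    rw [Fintype.card_fin]
    push_cast
    linarith)
  refine ⟨⌈T⌉₊, w, Nat.le_ceil T, fun i => ⟨(hw i).1, ?_, (hw i).2.2⟩, hdisj⟩
  have h : ((w i).2.2.length : ℝ) ≤ ((2 * K + 1 : ℕ) : ℝ) := by exact_mod_cast (hw i).2.1
  push_cast at h
  linarith
end

section
/- Let f_1,…,f_n be a basis of ℝ^n, let M be the matrix with columns f_1,…,f_n, let L be the lattice {k_1 f_1 + ⋯ + k_n f_n : k_1,…,k_n ∈ ℤ}, let B := {t_1 f_1 + ⋯ + t_n f_n : t_1,…,t_n ∈ (−1/2, 1/2]}, and for x ∈ ℝ^n let τ_B(x) be the unique point of B with x − τ_B(x) ∈ L. Suppose S ⊆ ℝ^n satisfies diam(S) := sup_{x,y∈S} ‖x−y‖_∞ < 1/(2‖M^{−1}‖_∞) and S ∩ B ∩ span{f_j : j ∈ J} ≠ ∅ for some J ⊆ [n]. Then for every x ∈ S, x − τ_B(x) = Σ_{j∈J} k_j f_j with each k_j ∈ {−1, 0, 1}. -/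
/-- The lattice generated by the columns of `M`. -/
def latticeOf (n : ℕ) (M : Matrix (Fin n) (Fin n) ℝ) : Set (Fin n → ℝ) :=
  {x | ∃ k : Fin n → ℤ, x = M.mulVec fun j => (k j : ℝ)}

/-- The fundamental cell `B = {t₁f₁ + ⋯ + tₙfₙ : tⱼ ∈ (−1/2, 1/2]}` for the columns of `M`. -/
def cellOf (n : ℕ) (M : Matrix (Fin n) (Fin n) ℝ) : Set (Fin n → ℝ) :=
  {x | ∃ t : Fin n → ℝ, (∀ j, t j ∈ Set.Ioc (-(1 : ℝ) / 2) (1 / 2)) ∧ x = M.mulVec t}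

/-- The coordinates of a vector with respect to the columns of `M` vanish outside `J`
as soon as the vector lies in the span of the columns indexed by `J`. -/
theorem Matrix.inv_mulVec_apply_eq_zero_of_mem_span {n : ℕ} {M : Matrix (Fin n) (Fin n) ℝ}
    (hM : IsUnit M.det) {J : Set (Fin n)} {y : Fin n → ℝ}
    (hy : y ∈ Submodule.span ℝ ((fun j => fun i => M i j) '' J)) {j : Fin n} (hj : j ∉ J) :
    M⁻¹.mulVec y j = 0 := by
  suffices h : Submodule.span ℝ ((fun j => fun i => M i j) '' J) ≤
      LinearMap.ker ((LinearMap.proj j).comp M⁻¹.mulVecLin) by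
    simpa using h hy
  rw [Submodule.span_le]
  rintro _ ⟨i, hi, rfl⟩
  have hij : j ≠ i := fun h => hj (h ▸ hi)
  have h : (M⁻¹ * M) j i = 0 := by
    rw [Matrix.nonsing_inv_mul M hM, Matrix.one_apply_ne hij]
  simpa [Matrix.mul_apply, Matrix.mulVec, dotProduct] using h

/-- An absolute row sum bound controls the entries of a matrix-vector product. -/
theorem Matrix.abs_mulVec_apply_le {m n : Type*} [Fintype n] {A : Matrix m n ℝ} {i : m} {c : ℝ}
    (hc : ∑ j, |A i j| ≤ c) (v : n → ℝ) : |A.mulVec v i| ≤ c * ‖v‖ :=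
  calc |A.mulVec v i| ≤ ∑ j, |A i j * v j| := Finset.abs_sum_le_sum_abs _ _
    _ ≤ ∑ j, |A i j| * ‖v‖ := by
      refine Finset.sum_le_sum fun j _ => ?_
      rw [abs_mul]
      exact mul_le_mul_of_nonneg_left (norm_le_pi_norm v j) (abs_nonneg _)
    _ = (∑ j, |A i j|) * ‖v‖ := (Finset.sum_mul _ _ _).symm
    _ ≤ c * ‖v‖ := mul_le_mul_of_nonneg_right hc (norm_nonneg v)

/-- If `S` has `diam(S) < 1/(2‖M⁻¹‖_∞)` and `S ∩ B ∩ span{f_j : j ∈ J} ≠ ∅`,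
then for every `x ∈ S`, `x − τ_B(x) = Σ_{j∈J} k_j f_j` with each `k_j ∈ {−1,0,1}`. -/
theorem sub_tau_mem_span_of_small_diam (n : ℕ) (M : Matrix (Fin n) (Fin n) ℝ)
    (hM : IsUnit M.det)
    (τ : (Fin n → ℝ) → Fin n → ℝ)
    (hτ : ∀ x, τ x ∈ cellOf n M ∧ x - τ x ∈ latticeOf n M)
    (S : Set (Fin n → ℝ)) (c : ℝ)
    (hc : ∀ i, ∑ j, |M⁻¹ i j| ≤ c)
    (hdiam : ∀ x ∈ S, ∀ y ∈ S, ‖x - y‖ < 1 / (2 * c))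
    (J : Set (Fin n))
    (hne : (S ∩ cellOf n M ∩
      (Submodule.span ℝ ((fun j => fun i => M i j) '' J) : Set (Fin n → ℝ))).Nonempty) :
    ∀ x ∈ S, ∃ k : Fin n → ℤ,
      (∀ j, k j = -1 ∨ k j = 0 ∨ k j = 1) ∧ (∀ j ∉ J, k j = 0) ∧
      x - τ x = M.mulVec fun j => (k j : ℝ) := by
  intro x hx
  obtain ⟨y, ⟨hyS, s, hs, hys⟩, hyJ⟩ := hne
  obtain ⟨⟨t, ht, hxt⟩, k, hk⟩ := hτ x
  have hinv (v : Fin n → ℝ) : M⁻¹.mulVec (M.mulVec v) = v := by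
    rw [Matrix.mulVec_mulVec, Matrix.nonsing_inv_mul M hM, Matrix.one_mulVec]
  have hc0 : 0 < c := by
    have h := (norm_nonneg _).trans_lt (hdiam x hx x hx)
    have := one_div_pos.mp h
    linarith
  have hdiff : M⁻¹.mulVec (x - y) = (fun j => (k j : ℝ)) + t - s := by
    have hx' : x - y = M.mulVec ((fun j => (k j : ℝ)) + t - s) := by
      rw [Matrix.mulVec_sub, Matrix.mulVec_add, ← hk, ← hxt, ← hys, sub_add_cancel]
    rw [hx', hinv]
  have hclose (j : Fin n) : |(k j : ℝ) + t j - s j| < 1 / 2 := by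
    have h := Matrix.abs_mulVec_apply_le (hc j) (x - y)
    rw [hdiff] at h
    refine h.trans_lt ?_
    have h2 := hdiam x hx y hyS
    rw [lt_div_iff₀ (by positivity)] at h2
    linarith
  refine ⟨k, fun j => ?_, fun j hj => ?_, hk⟩
  · obtain ⟨h1, h2⟩ := abs_lt.mp (hclose j)
    obtain ⟨h3, h4⟩ := ht j
    obtain ⟨h5, h6⟩ := hs j
    have hl : (-2 : ℝ) < k j := by linarith
    have hu : (k j : ℝ) < 2 := by linarith
    have hl' : -2 < k j := by exact_mod_cast hl
    have hu' : k j < 2 := by exact_mod_cast hu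
    lia
  · have hs0 : s j = 0 := by
      have h := Matrix.inv_mulVec_apply_eq_zero_of_mem_span hM hyJ hj
      rwa [hys, hinv] at h
    obtain ⟨h1, h2⟩ := abs_lt.mp (hclose j)
    obtain ⟨h3, h4⟩ := ht j
    have hl : (-1 : ℝ) < k j := by linarith
    have hu : (k j : ℝ) < 1 := by linarith
    have hl' : -1 < k j := by exact_mod_cast hl
    have hu' : k j < 1 := by exact_mod_cast hu
    lia
end

section
/- Let f_1,…,f_n be a basis of ℝ^n, let M be the matrix with columns f_1,…,f_n, let L be the lattice {k_1 f_1 + ⋯ + k_n f_n : k_1,…,k_n ∈ ℤ}, let B := {t_1 f_1 + ⋯ + t_n f_n : t_1,…,t_n ∈ (−1/2, 1/2]}, and for x ∈ ℝ^n let τ_B(x) be the unique point of B with x − τ_B(x) ∈ L; for S ⊆ ℝ^n write τ_B(S) = {τ_B(x) : x ∈ S}. Let S_1,…,S_m ⊆ ℝ^n be sets with diam(S_k) := sup_{x,y∈S_k} ‖x−y‖_∞ < 1/(2‖M^{−1}‖_∞) for each k. Then there exist ξ_1,…,ξ_m ∈ L such that ∩_{k=1}^m τ_B(S_k) = τ_B(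 ∩_{k=1}^m (ξ_k + S_k) ), and the vectors ξ_1,…,ξ_m are determined uniquely up to adding a common lattice vector to all of them (provided the intersection is nonempty). -/
theorem sub_mem_latticeOf {n : ℕ} {M : Matrix (Fin n) (Fin n) ℝ} {x y : Fin n → ℝ}
    (hx : x ∈ latticeOf n M) (hy : y ∈ latticeOf n M) : x - y ∈ latticeOf n M := by
  obtain ⟨k, rfl⟩ := hx
  obtain ⟨l, rfl⟩ := hy
  refine ⟨k - l, ?_⟩
  rw [← Matrix.mulVec_sub]
  congr 1
  ext j
  simp

theorem zero_mem_latticeOf (n : ℕ) (M : Matrix (Fin n) (Fin n) ℝ) : 0 ∈ latticeOf n M := by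
  refine ⟨0, ?_⟩
  ext i
  simp [Matrix.mulVec, dotProduct]

theorem neg_mem_latticeOf {n : ℕ} {M : Matrix (Fin n) (Fin n) ℝ} {x : Fin n → ℝ}
    (hx : x ∈ latticeOf n M) : -x ∈ latticeOf n M := by
  simpa using sub_mem_latticeOf (zero_mem_latticeOf n M) hx

theorem add_mem_latticeOf {n : ℕ} {M : Matrix (Fin n) (Fin n) ℝ} {x y : Fin n → ℝ}
    (hx : x ∈ latticeOf n M) (hy : y ∈ latticeOf n M) : x + y ∈ latticeOf n M := by
  simpa using sub_mem_latticeOf hx (neg_mem_latticeOf hy)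

/-- A lattice vector whose coordinates in the basis of columns all lie in `(-1, 1)` vanishes. -/
theorem eq_zero_of_mem_latticeOf {n : ℕ} {M : Matrix (Fin n) (Fin n) ℝ} (hM : IsUnit M.det)
    {v : Fin n → ℝ} (hv : v ∈ latticeOf n M) (h : ∀ i, |M⁻¹.mulVec v i| < 1) : v = 0 := by
  obtain ⟨k, rfl⟩ := hv
  have hk : k = 0 := by
    ext i
    have hi := h i
    rw [Matrix.mulVec_mulVec, Matrix.nonsing_inv_mul _ hM, Matrix.one_mulVec] at hi
    exact Int.abs_lt_one_iff.mp (by exact_mod_cast hi)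
  subst hk
  ext i
  simp [Matrix.mulVec, dotProduct]

theorem eq_of_mem_cellOf {n : ℕ} {M : Matrix (Fin n) (Fin n) ℝ} (hM : IsUnit M.det)
    {x y : Fin n → ℝ} (hx : x ∈ cellOf n M) (hy : y ∈ cellOf n M)
    (hxy : x - y ∈ latticeOf n M) : x = y := by
  refine sub_eq_zero.mp (eq_zero_of_mem_latticeOf hM hxy fun i => ?_)
  obtain ⟨s, hs, rfl⟩ := hx
  obtain ⟨t, ht, rfl⟩ := hy
  rw [← Matrix.mulVec_sub, Matrix.mulVec_mulVec, Matrix.nonsing_inv_mul _ hM,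
    Matrix.one_mulVec, Pi.sub_apply, abs_lt]
  have h1 := hs i
  have h2 := ht i
  constructor <;> linarith [h1.1, h1.2, h2.1, h2.2]

theorem abs_mulVec_lt_half {n : ℕ} {A : Matrix (Fin n) (Fin n) ℝ} {c : ℝ}
    (hc : ∀ i, ∑ j, |A i j| ≤ c) {v : Fin n → ℝ} (hv : ‖v‖ < 1 / (2 * c)) (i : Fin n) :
    |A.mulVec v i| < 1 / 2 := by
  have hpos : 0 < 2 * c := one_div_pos.mp ((norm_nonneg v).trans_lt hv)
  rw [lt_div_iff₀ hpos] at hv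
  calc |A.mulVec v i| ≤ ∑ j, |A i j * v j| := by
        rw [Matrix.mulVec_eq_sum]
        simpa [mul_comm] using Finset.abs_sum_le_sum_abs (fun j => A i j * v j) Finset.univ
    _ ≤ ∑ j, |A i j| * ‖v‖ := by
        refine Finset.sum_le_sum fun j _ => ?_
        rw [abs_mul]
        exact mul_le_mul_of_nonneg_left (norm_le_pi_norm v j) (abs_nonneg _)
    _ = (∑ j, |A i j|) * ‖v‖ := (Finset.sum_mul _ _ _).symm
    _ ≤ c * ‖v‖ := mul_le_mul_of_nonneg_right (hc i) (norm_nonneg v)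
    _ < 1 / 2 := by linarith

/-- Short vectors that are congruent modulo the lattice are equal. -/
theorem eq_of_norm_lt_of_sub_mem_latticeOf {n : ℕ} {M : Matrix (Fin n) (Fin n) ℝ}
    (hM : IsUnit M.det) {c : ℝ} (hc : ∀ i, ∑ j, |M⁻¹ i j| ≤ c) {v w : Fin n → ℝ}
    (hv : ‖v‖ < 1 / (2 * c)) (hw : ‖w‖ < 1 / (2 * c)) (hvw : v - w ∈ latticeOf n M) :
    v = w := by
  refine sub_eq_zero.mp (eq_zero_of_mem_latticeOf hM hvw fun i => ?_)
  have h1 := abs_mulVec_lt_half hc hv i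
  have h2 := abs_mulVec_lt_half hc hw i
  rw [Matrix.mulVec_sub, Pi.sub_apply]
  exact (abs_sub _ _).trans_lt (by linarith)

/-- If each `S_k` has `diam(S_k) < 1/(2‖M⁻¹‖_∞)`, then there are lattice
vectors `ξ_1,…,ξ_m` with `⋂ τ_B(S_k) = τ_B(⋂ (ξ_k + S_k))`, and they are unique up to adding a
common lattice vector provided the intersection is nonempty. -/
theorem inter_tau_image_eq (n m : ℕ) (hm : 1 ≤ m)
    (M : Matrix (Fin n) (Fin n) ℝ) (hM : IsUnit M.det)
    (τ : (Fin n → ℝ) → Fin n → ℝ)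
    (hτ : ∀ x, τ x ∈ cellOf n M ∧ x - τ x ∈ latticeOf n M)
    (S : Fin m → Set (Fin n → ℝ)) (c : ℝ)
    (hc : ∀ i, ∑ j, |M⁻¹ i j| ≤ c)
    (hdiam : ∀ k, ∀ x ∈ S k, ∀ y ∈ S k, ‖x - y‖ < 1 / (2 * c)) :
    ∃ ξ : Fin m → Fin n → ℝ, (∀ k, ξ k ∈ latticeOf n M) ∧
      (⋂ k, τ '' S k) = τ '' (⋂ k, (fun y => ξ k + y) '' S k) ∧
      ∀ ξ' : Fin m → Fin n → ℝ, (∀ k, ξ' k ∈ latticeOf n M) →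
        (⋂ k, τ '' S k) = τ '' (⋂ k, (fun y => ξ' k + y) '' S k) →
        (⋂ k, τ '' S k).Nonempty →
        ∃ ζ ∈ latticeOf n M, ∀ k, ξ' k = ζ + ξ k := by
  have tau_eq : ∀ {x y}, x - y ∈ latticeOf n M → τ x = τ y := fun {x y} h =>
    eq_of_mem_cellOf hM (hτ x).1 (hτ y).1 (by
      convert add_mem_latticeOf (sub_mem_latticeOf h (hτ x).2) (hτ y).2 using 1
      abel)
  have image_subset : ∀ ξ : Fin m → Fin n → ℝ, (∀ k, ξ k ∈ latticeOf n M) →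
      τ '' (⋂ k, (fun y => ξ k + y) '' S k) ⊆ ⋂ k, τ '' S k := by
    rintro ξ hξ _ ⟨x, hx, rfl⟩
    refine Set.mem_iInter.mpr fun k => ?_
    obtain ⟨y, hy, rfl⟩ := Set.mem_iInter.mp hx k
    exact ⟨y, hy, tau_eq (by simpa using neg_mem_latticeOf (hξ k))⟩
  rcases (⋂ k, τ '' S k).eq_empty_or_nonempty with hempty | ⟨p, hp⟩
  · refine ⟨0, fun _ => zero_mem_latticeOf n M, ?_, fun _ _ _ hne => ?_⟩
    · rw [hempty]
      exact (Set.subset_empty_iff.mp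
        (hempty ▸ image_subset 0 fun _ => zero_mem_latticeOf n M)).symm
    · exact absurd hempty hne.ne_empty
  choose s hs hsp using fun k => Set.mem_iInter.mp hp k
  have hξ : ∀ k, p - s k ∈ latticeOf n M := fun k => by
    have h := neg_mem_latticeOf (hτ (s k)).2
    rwa [hsp k, neg_sub] at h
  refine ⟨fun k => p - s k, hξ, Set.Subset.antisymm ?_ (image_subset _ hξ), ?_⟩
  · intro q hq
    choose t ht htq using fun k => Set.mem_iInter.mp hq k
    have htL : ∀ k, t k - q ∈ latticeOf n M := fun k => htq k ▸ (hτ (t k)).2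
    have hcommon : ∀ k l, t k - s k = t l - s l := fun k l =>
      eq_of_norm_lt_of_sub_mem_latticeOf hM hc (hdiam k _ (ht k) _ (hs k))
        (hdiam l _ (ht l) _ (hs l)) (by
          convert sub_mem_latticeOf (add_mem_latticeOf (htL k) (hξ k))
            (add_mem_latticeOf (htL l) (hξ l)) using 1
          abel)
    let k₀ : Fin m := ⟨0, hm⟩
    refine ⟨p - s k₀ + t k₀, Set.mem_iInter.mpr fun k => ⟨t k, ht k, ?_⟩, ?_⟩
    · have h := hcommon k k₀
      calc p - s k + t k = p + (t k - s k) := by abel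
        _ = p + (t k₀ - s k₀) := by rw [h]
        _ = p - s k₀ + t k₀ := by abel
    · rw [← htq k₀]
      exact tau_eq (by simpa using hξ k₀)
  · intro ξ' hξ' heq _
    obtain ⟨x, hx, hxp⟩ := heq ▸ hp
    have hxL : x - p ∈ latticeOf n M := hxp ▸ (hτ x).2
    refine ⟨x - p, hxL, fun k => ?_⟩
    obtain ⟨u, hu, hux⟩ := Set.mem_iInter.mp hx k
    have hx_eq : x = ξ' k + u := hux.symm
    have hus : u = s k := by
      refine sub_eq_zero.mp (eq_of_norm_lt_of_sub_mem_latticeOf hM hc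
        (hdiam k _ hu _ (hs k)) (by simpa using hdiam k _ hu _ hu) ?_)
      convert sub_mem_latticeOf (add_mem_latticeOf hxL (hξ k)) (hξ' k) using 1
      rw [hx_eq]
      abel
    ext i
    simp only [hx_eq, hus, Pi.add_apply, Pi.sub_apply]
    ring
end
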